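/- Let Ω ⊂ ℝⁿ be a nonempty open bounded convex set of class C² such that H(Ω) = Cut(Ω) =: S. Then S is a singleton and Ω is an open ball. -/

import Mathlib

open Metric Set Real

noncomputable section

abbrev E (n : ℕ) := EuclideanSpace ℝ (Fin n)

/-- The set of closest points to `x` on the boundary of `Ω`. -/
def projBd {n : ℕ} (Ω : Set (E n)) (x : E n) : Set (E n) :=
  {y ∈ frontier Ω | dist x y = infDist x (frontier Ω)}

/-- The skeleton `Σ(Ω)`: points of `Ω` with more than one closest boundary point. -/
def skeleton {n : ℕ} (Ω : Set (E n)) : Set (E n) :=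
  {x ∈ Ω | ∃ y ∈ projBd Ω x, ∃ z ∈ projBd Ω x, y ≠ z}

/-- The cut locus `Cut(Ω)`: the closure of the skeleton. -/
def cutLocus {n : ℕ} (Ω : Set (E n)) : Set (E n) := closure (skeleton Ω)

/-- The high ridge `H(Ω)`: the set where `d_{∂Ω}` attains its maximum over `closure Ω`. -/
def highRidge {n : ℕ} (Ω : Set (E n)) : Set (E n) :=
  {x ∈ closure Ω | ∀ z ∈ closure Ω, infDist z (frontier Ω) ≤ infDist x (frontier Ω)}

/-- A domain in `ℝ^{n+1}` is of class `C^k` if near each boundary point, in suitable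
orthonormal coordinates, its boundary is the graph of a `C^k` function of `n` variables
and the domain is the region above the graph. -/
def IsCkDomain (n : ℕ) (k : ℕ∞) (Ω : Set (E (n+1))) : Prop :=
  ∀ y ∈ frontier Ω, ∃ (e : E (n+1) ≃ᵃⁱ[ℝ] E (n+1)) (U : Set (E (n+1))) (g : E n → ℝ),
    IsOpen U ∧ y ∈ U ∧ ContDiff ℝ k g ∧
    (∀ z ∈ U, z ∈ Ω ↔
      g ((EuclideanSpace.equiv (Fin n) ℝ).symm (fun i => e z i.castSucc)) < e z (Fin.last n)) ∧
    (∀ z ∈ U, z ∈ frontier Ω ↔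
      g ((EuclideanSpace.equiv (Fin n) ℝ).symm (fun i => e z i.castSucc)) = e z (Fin.last n))

open Filter Topology
open scoped RealInnerProductSpace

theorem isLittleO_sq_of_eventually_eq_zero_left {f : ℝ → ℝ} (hf : ContDiff ℝ 2 f)
    (h0 : ∀ᶠ t in 𝓝[<] 0, f t = 0) : f =o[𝓝[>] 0] fun t => t ^ 2 := by
  have hf0 : f 0 = 0 := tendsto_nhds_unique
    ((hf.continuous.tendsto 0).mono_left nhdsWithin_le_nhds)
    (tendsto_const_nhds.congr' (h0.mono fun t ht => ht.symm))
  have hdiff : Differentiable ℝ f := hf.differentiable (by norm_num)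
  have hd1 : ContDiff ℝ 1 (deriv f) := by
    have : ContDiff ℝ (1 + 1) f := by simpa [one_add_one_eq_two] using hf
    exact (contDiff_succ_iff_deriv.1 this).2.2
  have hd0 : ∀ᶠ t in 𝓝[<] (0 : ℝ), deriv f t = 0 := by
    filter_upwards [eventually_eventually_nhdsWithin.2 h0, self_mem_nhdsWithin] with t ht htneg
    rw [isOpen_Iio.nhdsWithin_eq htneg] at ht
    have : f =ᶠ[𝓝 t] fun _ => 0 := ht
    rw [this.deriv_eq, deriv_const]
  have hd00 : deriv f 0 = 0 := tendsto_nhds_unique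
    ((hd1.continuous.tendsto 0).mono_left nhdsWithin_le_nhds)
    (tendsto_const_nhds.congr' (hd0.mono fun t ht => ht.symm))
  have hdd : HasDerivAt (deriv f) (deriv (deriv f) 0) 0 :=
    (hd1.differentiable (by norm_num) 0).hasDerivAt
  have hdd0 : deriv (deriv f) 0 = 0 := by
    have h1 : HasDerivWithinAt (deriv f) (deriv (deriv f) 0) (Iio 0) 0 := hdd.hasDerivWithinAt
    have h2 : HasDerivWithinAt (deriv f) 0 (Iio 0) 0 :=
      (hasDerivWithinAt_const (0 : ℝ) (Iio 0) (0 : ℝ)).congr_of_eventuallyEq hd0 hd00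
    exact (uniqueDiffWithinAt_Iio 0).eq_deriv _ h1 h2
  rw [hdd0, hasDerivAt_iff_isLittleO] at hdd
  simp only [hd00, sub_zero, smul_zero] at hdd
  rw [Asymptotics.isLittleO_iff] at hdd ⊢
  intro c hc
  obtain ⟨δ, hδ, hball⟩ := Metric.eventually_nhds_iff.1 (hdd hc)
  filter_upwards [Ioo_mem_nhdsGT hδ] with t ht
  have := (convex_Icc (0 : ℝ) t).norm_image_sub_le_of_norm_deriv_le (f := f) (C := c * t)
    (fun x _ => hdiff x) (fun x hx => ?_) (left_mem_Icc.2 ht.1.le) (right_mem_Icc.2 ht.1.le)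
  · rw [hf0, sub_zero, sub_zero] at this
    rw [norm_pow]
    refine this.trans_eq ?_
    rw [Real.norm_of_nonneg ht.1.le]; ring
  · have hx' : dist x 0 < δ := by
      rw [dist_zero_right, Real.norm_of_nonneg hx.1]; exact hx.2.trans_lt ht.2
    refine (hball hx').trans ?_
    rw [Real.norm_of_nonneg hx.1]
    exact mul_le_mul_of_nonneg_left hx.2 hc.le

theorem IsOpen.infDist_frontier_pos {X : Type*} [PseudoMetricSpace X] {Ω : Set X}
    (hΩ : IsOpen Ω) (hne : (frontier Ω).Nonempty) {z : X} (hz : z ∈ Ω) : 0 < infDist z (frontier Ω) :=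
  (isClosed_frontier.notMem_iff_infDist_pos hne).1 fun h => by
    rw [hΩ.frontier_eq] at h
    exact h.2 hz

section Geometry

variable {V : Type*} [NormedAddCommGroup V] [InnerProductSpace ℝ V]

theorem ball_infDist_frontier_subset {Ω : Set V} (hΩ : IsOpen Ω) {x : V} (hx : x ∈ Ω) :
    ball x (infDist x (frontier Ω)) ⊆ Ω := by
  rcases le_or_gt (infDist x (frontier Ω)) 0 with h0 | h0
  · rw [ball_eq_empty.2 h0]; exact empty_subset _
  refine (convex_ball _ _).isPreconnected.subset_of_closure_inter_subset hΩ
    ⟨x, mem_ball_self h0, hx⟩ ?_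
  rintro z ⟨hzc, hzb⟩
  by_contra hzΩ
  have hzf : z ∈ frontier Ω := hΩ.frontier_eq ▸ ⟨hzc, hzΩ⟩
  have h := infDist_le_dist_of_mem (x := x) hzf
  rw [mem_ball, dist_comm] at hzb
  linarith

theorem IsCompact.inner_sub_nonpos_of_infDist_le {K : Set V} (hK : IsCompact K) {m y h : V}
    (hy : ∀ z ∈ K, dist m z = infDist m K → z = y) (hne : K.Nonempty)
    (hmax : ∀ᶠ s : ℝ in 𝓝[>] 0, infDist (m + s • h) K ≤ infDist m K) :
    ⟪h, m - y⟫ ≤ 0 := by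
  set s : ℕ → ℝ := fun k => 1 / ((k : ℝ) + 1) with hs
  have hspos : ∀ k, 0 < s k := fun k => by positivity
  have hs0 : Tendsto s atTop (𝓝 0) := tendsto_one_div_add_atTop_nhds_zero_nat
  have hs' : Tendsto s atTop (𝓝[>] 0) :=
    tendsto_nhdsWithin_iff.2 ⟨hs0, Eventually.of_forall hspos⟩
  choose Y hYK hY using fun k => hK.exists_infDist_eq_dist hne (m + s k • h)
  obtain ⟨y₀, hy₀K, φ, hφ, hlim⟩ := hK.tendsto_subseq hYK
  have hsφ : Tendsto (fun k => s (φ k)) atTop (𝓝 0) := hs0.comp hφ.tendsto_atTop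
  have hpt : Tendsto (fun k => m + s (φ k) • h) atTop (𝓝 m) := by
    simpa using (tendsto_const_nhds (x := m)).add (hsφ.smul_const h)
  have hy₀ : y₀ = y := by
    refine hy y₀ hy₀K (tendsto_nhds_unique (hpt.dist hlim) ?_)
    have := ((continuous_infDist_pt K).tendsto m).comp hpt
    refine this.congr fun k => ?_
    exact hY (φ k)
  rw [← hy₀]
  have hinner : Tendsto (fun k => ⟪h, m - Y (φ k)⟫) atTop (𝓝 ⟪h, m - y₀⟫) :=
    tendsto_const_nhds.inner (tendsto_const_nhds.sub hlim)
  refine le_of_tendsto hinner ?_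
  filter_upwards [(hs'.comp hφ.tendsto_atTop).eventually hmax] with k hk
  simp only [Function.comp_apply] at hk
  rw [hY (φ k)] at hk
  have h1 : dist (m + s (φ k) • h) (Y (φ k)) ≤ dist m (Y (φ k)) :=
    hk.trans (infDist_le_dist_of_mem (hYK _))
  rw [dist_eq_norm, dist_eq_norm, add_sub_right_comm] at h1
  have h2 := pow_le_pow_left₀ (norm_nonneg _) h1 2
  rw [norm_add_sq_real, inner_smul_right, real_inner_comm] at h2
  by_contra! hcon
  have := mul_pos (hspos (φ k)) hcon
  nlinarith [sq_nonneg ‖s (φ k) • h‖]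

theorem IsCompact.exists_infDist_eq_add [ProperSpace V] {K : Set V} (hK : IsCompact K)
    (hne : K.Nonempty) {z : V} {ε : ℝ} (hε : 0 < ε) (hεz : ε ≤ infDist z K)
    (huniq : ∀ m ∈ closedBall z ε, ∀ x ∈ K, ∀ y ∈ K,
      dist m x = infDist m K → dist m y = infDist m K → x = y) :
    ∃ m, dist z m = ε ∧ infDist m K = infDist z K + ε := by
  obtain ⟨m, hm, hmax⟩ := (isCompact_closedBall z ε).exists_isMaxOn
    ⟨z, mem_closedBall_self hε.le⟩ (continuous_infDist_pt K).continuousOn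
  rw [isMaxOn_iff] at hmax
  obtain ⟨y, hyK, hy⟩ := hK.exists_infDist_eq_dist hne m
  set D := infDist m K with hD
  have hzD : infDist z K ≤ D := hmax z (mem_closedBall_self hε.le)
  have hDpos : 0 < D := by linarith
  have hnD : ‖m - y‖ = D := by rw [← dist_eq_norm, hy]
  have hnm : ‖m - z‖ ≤ ε := by rw [← dist_eq_norm]; exact hm
  have hkey : ε * D ≤ ⟪m - z, m - y⟫ := by
    by_contra! hlt
    set h : V := ε • (m - y) - D • (m - z) with hh
    have hle : ⟪h, m - y⟫ ≤ 0 := by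
      refine hK.inner_sub_nonpos_of_infDist_le
        (fun x hx hxm => huniq m hm x hx y hyK hxm hy.symm) hne ?_
      have hev : ∀ᶠ s : ℝ in 𝓝[>] 0, m + s • h ∈ closedBall z ε := by
        rcases hnm.lt_or_eq with hlt' | heq
        · have hc : ContinuousAt (fun s : ℝ => m + s • h) 0 := by fun_prop
          have hmem : ball z ε ∈ 𝓝 (m + (0 : ℝ) • h) := by
            refine isOpen_ball.mem_nhds ?_
            simpa [dist_eq_norm] using hlt'
          exact ((hc.eventually hmem).filter_mono nhdsWithin_le_nhds).mono
            fun s hs => ball_subset_closedBall hs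
        · have hneg : ⟪m - z, h⟫ < 0 := by
            rw [hh, inner_sub_right, inner_smul_right, inner_smul_right,
              real_inner_self_eq_norm_sq, heq]
            nlinarith
          have hc : ContinuousAt (fun s : ℝ => 2 * ⟪m - z, h⟫ + s * ‖h‖ ^ 2) 0 := by fun_prop
          have hev0 : ∀ᶠ s : ℝ in 𝓝 0, 2 * ⟪m - z, h⟫ + s * ‖h‖ ^ 2 < 0 :=
            hc.eventually (Iio_mem_nhds (by simp only [zero_mul, add_zero]; linarith))
          filter_upwards [hev0.filter_mono nhdsWithin_le_nhds, self_mem_nhdsWithin] with s hs hs0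
          have hs0 : 0 < s := hs0
          rw [mem_closedBall, dist_eq_norm, add_sub_right_comm]
          refine (sq_le_sq₀ (norm_nonneg _) hε.le).1 ?_
          rw [norm_add_sq_real, inner_smul_right, norm_smul, heq, mul_pow, Real.norm_eq_abs, sq_abs]
          nlinarith
      exact hev.mono fun s hs => hmax _ hs
    rw [hh, inner_sub_left, inner_smul_left, inner_smul_left, real_inner_self_eq_norm_sq, hnD] at hle
    simp only [conj_trivial] at hle
    nlinarith
  have hzy : dist z y ≤ D - ε := by
    refine (sq_le_sq₀ dist_nonneg (by linarith)).1 ?_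
    have : z - y = (m - y) - (m - z) := by abel
    rw [dist_eq_norm, this, norm_sub_sq_real, hnD, real_inner_comm]
    nlinarith [norm_nonneg (m - z)]
  have h1 := infDist_le_dist_of_mem (x := z) hyK
  have h2 := infDist_le_infDist_add_dist (s := K) (x := m) (y := z)
  have h3 : dist m z ≤ ε := hm
  refine ⟨m, ?_, ?_⟩
  · rw [dist_comm]; linarith
  · linarith

theorem fderiv_eq_zero_of_segment_arc {F : V → ℝ} (hF : ContDiff ℝ 2 F) {p u w : V} {ρ : ℝ}
    (hρ : 0 < ρ) (hw : ‖w‖ = 1)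
    (hseg : ∀ᶠ t : ℝ in 𝓝[<] 0, F (p + ρ • w + t • u) = 0)
    (harc : ∀ᶠ t : ℝ in 𝓝[>] 0, F (p + √(ρ ^ 2 - t ^ 2) • w + t • u) = 0) :
    fderiv ℝ F (p + ρ • w) w = 0 := by
  set κ := fderiv ℝ F (p + ρ • w) w with hκ
  by_contra hne
  have hφ : (fun t : ℝ => F (p + ρ • w + t • u)) =o[𝓝[>] 0] fun t => t ^ 2 :=
    isLittleO_sq_of_eventually_eq_zero_left (by fun_prop) hseg
  have hstrict : HasStrictFDerivAt F (fderiv ℝ F (p + ρ • w)) (p + ρ • w) :=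
    hF.contDiffAt.hasStrictFDerivAt (by norm_num)
  have hlim : Tendsto (fun t : ℝ => (p + ρ • w + t • u, p + √(ρ ^ 2 - t ^ 2) • w + t • u))
      (𝓝[>] 0) (𝓝 (p + ρ • w, p + ρ • w)) := by
    have hc : Continuous (fun t : ℝ => (p + ρ • w + t • u, p + √(ρ ^ 2 - t ^ 2) • w + t • u)) := by
      fun_prop
    have := (hc.tendsto 0).mono_left (nhdsWithin_le_nhds (s := Ioi 0))
    simpa [Real.sqrt_sq hρ.le] using this
  have hb := (Asymptotics.isLittleO_iff.1 (hstrict.isLittleO.comp_tendsto hlim))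
    (c := |κ| / 2) (by positivity)
  have hs := (Asymptotics.isLittleO_iff.1 hφ) (c := |κ| / (8 * ρ)) (by positivity)
  obtain ⟨t, hb, hs, hz, ht⟩ := (hb.and (hs.and (harc.and (Ioo_mem_nhdsGT hρ)))).exists
  set b := ρ - √(ρ ^ 2 - t ^ 2) with hbdef
  have hdiff : p + ρ • w + t • u - (p + √(ρ ^ 2 - t ^ 2) • w + t • u) = b • w := by
    rw [hbdef, sub_smul]; abel
  simp only [Function.comp_apply, hdiff, hz, sub_zero, map_smul, ← hκ, norm_smul, hw, mul_one,
    smul_eq_mul, Real.norm_eq_abs] at hb hs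
  have hsq : √(ρ ^ 2 - t ^ 2) ^ 2 = ρ ^ 2 - t ^ 2 := Real.sq_sqrt (by nlinarith [ht.1, ht.2])
  have hsn : 0 ≤ √(ρ ^ 2 - t ^ 2) := Real.sqrt_nonneg _
  have hsle : √(ρ ^ 2 - t ^ 2) ≤ ρ := by nlinarith [sq_nonneg t]
  have hb0 : 0 ≤ b := by linarith
  have hb2 : t ^ 2 ≤ 2 * ρ * b := by nlinarith
  have ht2 : 0 < t ^ 2 := pow_pos ht.1 2
  have hκpos : 0 < |κ| := abs_pos.2 hne
  rw [abs_of_nonneg hb0] at hb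
  rw [abs_of_nonneg ht2.le] at hs
  have htri : b * |κ| ≤ |F (p + ρ • w + t • u)| + |F (p + ρ • w + t • u) - b * κ| := by
    have := abs_sub_abs_le_abs_sub (b * κ) (F (p + ρ • w + t • u))
    rw [abs_mul, abs_of_nonneg hb0, abs_sub_comm] at this
    linarith
  have hs' : |F (p + ρ • w + t • u)| ≤ |κ| / 4 * b := by
    refine hs.trans ?_
    calc |κ| / (8 * ρ) * t ^ 2 ≤ |κ| / (8 * ρ) * (2 * ρ * b) := by gcongr
      _ = |κ| / 4 * b := by field_simp; ring
  have hbpos : 0 < b := by nlinarith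
  nlinarith [mul_pos hκpos hbpos]

theorem fderiv_ne_zero_of_pos_on_ball {F : V → ℝ} {p w k : V} {ρ : ℝ} (hρ : 0 < ρ)
    (hw : ‖w‖ = 1) (hF : DifferentiableAt ℝ F (p + ρ • w)) (hF0 : F (p + ρ • w) = 0)
    (hk : fderiv ℝ F (p + ρ • w) k = 1)
    (hpos : ∀ᶠ z in 𝓝 (p + ρ • w), z ∈ ball p ρ → 0 < F z) :
    fderiv ℝ F (p + ρ • w) w ≠ 0 := by
  intro hzero
  set h : V := -k - (|⟪w, k⟫| + 1) • w with hh
  have hwh : ⟪w, h⟫ < 0 := by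
    rw [hh, inner_sub_right, inner_neg_right, inner_smul_right, real_inner_self_eq_norm_sq, hw]
    linarith [neg_abs_le ⟪w, k⟫]
  have hDh : fderiv ℝ F (p + ρ • w) h = -1 := by
    rw [hh, map_sub, map_neg, map_smul, hk, hzero]; simp
  have hline : HasDerivAt (fun t : ℝ => F (p + ρ • w + t • h)) (-1) 0 := by
    have h1 : HasDerivAt (fun t : ℝ => p + ρ • w + t • h) h 0 := by
      simpa using ((hasDerivAt_id (0 : ℝ)).smul_const h).const_add (p + ρ • w)
    have h2 : HasFDerivAt F (fderiv ℝ F (p + ρ • w)) (p + ρ • w + (0 : ℝ) • h) := by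
      simpa using hF.hasFDerivAt
    simpa [hDh, Function.comp_def] using h2.comp_hasDerivAt 0 h1
  have hslope : Tendsto (slope (fun t : ℝ => F (p + ρ • w + t • h)) 0) (𝓝[>] 0) (𝓝 (-1)) :=
    (hasDerivAt_iff_tendsto_slope.1 hline).mono_left
    (nhdsWithin_mono (s := Ioi 0) 0 fun t ht => (mem_Ioi.1 ht).ne')
  have hneg := hslope.eventually (Iio_mem_nhds (show (-1 : ℝ) < 0 by norm_num))
  have hcont : Tendsto (fun t : ℝ => p + ρ • w + t • h) (𝓝[>] 0) (𝓝 (p + ρ • w)) := by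
    have hc : Continuous (fun t : ℝ => p + ρ • w + t • h) := by fun_prop
    simpa using (hc.tendsto 0).mono_left (nhdsWithin_le_nhds (s := Ioi 0))
  have hc : ContinuousAt (fun t : ℝ => 2 * (ρ * ⟪w, h⟫) + t * ‖h‖ ^ 2) 0 := by fun_prop
  have hev0 : ∀ᶠ t : ℝ in 𝓝 0, 2 * (ρ * ⟪w, h⟫) + t * ‖h‖ ^ 2 < 0 :=
    hc.eventually (Iio_mem_nhds (by
      simp only [zero_mul, add_zero]
      linarith [mul_neg_of_pos_of_neg hρ hwh]))
  obtain ⟨t, ht1, ht2, ht3, ht⟩ := (hneg.and ((hcont.eventually hpos).and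
    ((hev0.filter_mono nhdsWithin_le_nhds).and
      (self_mem_nhdsWithin : Ioi (0 : ℝ) ∈ 𝓝[>] 0)))).exists
  have ht : 0 < t := ht
  have hmem : p + ρ • w + t • h ∈ ball p ρ := by
    rw [mem_ball, dist_eq_norm, ← sq_lt_sq₀ (norm_nonneg _) hρ.le]
    have : p + ρ • w + t • h - p = ρ • w + t • h := by abel
    rw [this, norm_add_sq_real, inner_smul_left, inner_smul_right, norm_smul, norm_smul, hw]
    simp only [conj_trivial, mul_pow, Real.norm_eq_abs, sq_abs]
    nlinarith
  have hFpos := ht2 hmem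
  simp only [slope_def_field, zero_smul, add_zero, sub_zero, hF0] at ht1
  have := div_pos hFpos ht
  linarith

theorem add_smul_mem_frontier_thickening {S : Set V} {s v : V} {ρ : ℝ} (hρ : 0 < ρ) (hs : s ∈ S)
    (hv : ‖v‖ = 1) (hnormal : ∀ s' ∈ S, ⟪s' - s, v⟫ ≤ 0) :
    s + ρ • v ∈ frontier (thickening ρ S) := by
  rw [isOpen_thickening.frontier_eq]
  refine ⟨closure_mono (ball_subset_thickening hs ρ) ?_, fun hmem => ?_⟩
  · rw [closure_ball s hρ.ne', mem_closedBall, dist_eq_norm, add_sub_cancel_left, norm_smul, hv,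
      mul_one, Real.norm_of_nonneg hρ.le]
  · obtain ⟨s', hs', hd⟩ := mem_thickening_iff.1 hmem
    have h1 : ⟪s + ρ • v - s', v⟫ ≤ ‖s + ρ • v - s'‖ * ‖v‖ := real_inner_le_norm _ _
    have h2 : s + ρ • v - s' = ρ • v - (s' - s) := by abel
    rw [hv, mul_one, ← dist_eq_norm, h2, inner_sub_left, inner_smul_left,
      real_inner_self_eq_norm_sq, hv, conj_trivial] at h1
    linarith [hnormal s' hs']

theorem interior_eq_empty_of_dist_frontier_thickening {S : Set V} {ρ : ℝ} (hρ : 0 < ρ)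
    (hfr : ∀ s ∈ S, ∃ y ∈ frontier (thickening ρ S), dist s y = ρ) : interior S = ∅ := by
  by_contra! hne
  obtain ⟨x, hx⟩ := hne
  obtain ⟨y, hy, hxy⟩ := hfr x (interior_subset hx)
  have hc : ContinuousAt (fun t : ℝ => x + t • (y - x)) 0 := by fun_prop
  have hev : ∀ᶠ t : ℝ in 𝓝[>] 0, x + t • (y - x) ∈ S :=
    (hc.eventually (by simpa using mem_interior_iff_mem_nhds.1 hx)).filter_mono nhdsWithin_le_nhds
  obtain ⟨t, htS, ht0, ht1⟩ := (hev.and (Ioo_mem_nhdsGT one_pos)).exists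
  rw [isOpen_thickening.frontier_eq] at hy
  refine hy.2 (mem_thickening_iff.2 ⟨_, htS, ?_⟩)
  have : y - (x + t • (y - x)) = (1 - t) • (y - x) := by module
  rw [dist_eq_norm, this, norm_smul, ← dist_eq_norm y, dist_comm y, hxy,
    Real.norm_of_nonneg (by linarith)]
  nlinarith

theorem Convex.exists_unit_normal_of_interior_eq_empty [FiniteDimensional ℝ V] {S : Set V}
    (hS : Convex ℝ S) (hne : S.Nonempty) (hint : interior S = ∅) :
    ∃ w : V, ‖w‖ = 1 ∧ ∀ s ∈ S, ∀ s' ∈ S, ⟪s' - s, w⟫ = 0 := by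
  have hspan : vectorSpan ℝ S ≠ ⊤ := by
    intro htop
    rw [← direction_affineSpan, AffineSubspace.direction_eq_top_iff_of_nonempty
      ((affineSpan_nonempty ℝ).2 hne), ← hS.interior_nonempty_iff_affineSpan_eq_top, hint] at htop
    exact not_nonempty_empty htop
  rw [Ne, ← Submodule.orthogonal_eq_bot_iff] at hspan
  obtain ⟨w, hw, hw0⟩ := Submodule.exists_mem_ne_zero_of_ne_bot hspan
  refine ⟨‖w‖⁻¹ • w, norm_smul_inv_norm hw0, fun s hs s' hs' => ?_⟩
  have h0 : ⟪s' - s, w⟫ = 0 :=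
    (Submodule.mem_orthogonal _ _).1 hw _ (vsub_mem_vectorSpan ℝ hs' hs)
  rw [inner_smul_right, h0, mul_zero]

theorem IsCompact.exists_unit_sub_inner_nonpos {S : Set V} (hS : IsCompact S)
    (hnt : S.Nontrivial) :
    ∃ p ∈ S, ∃ q ∈ S, ∃ u : V, ‖u‖ = 1 ∧ q = p - dist p q • u ∧ 0 < dist p q ∧
      ∀ s ∈ S, ⟪s - p, u⟫ ≤ 0 := by
  obtain ⟨⟨p, q⟩, ⟨hp, hq⟩, hmax⟩ := (hS.prod hS).exists_isMaxOn (hnt.nonempty.prod hnt.nonempty)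
    (continuous_dist (α := V)).continuousOn
  rw [isMaxOn_iff] at hmax
  obtain ⟨a, ha, b, hb, hab⟩ := hnt
  have hL : 0 < dist p q := (dist_pos.2 hab).trans_le (hmax (a, b) ⟨ha, hb⟩)
  have hpq : p - q ≠ 0 := by rwa [← norm_pos_iff, ← dist_eq_norm]
  refine ⟨p, hp, q, hq, ‖p - q‖⁻¹ • (p - q), norm_smul_inv_norm hpq, ?_, hL, fun s hs => ?_⟩
  · rw [dist_eq_norm, smul_inv_smul₀ (norm_ne_zero_iff.2 hpq), sub_sub_cancel]
  · have h1 : dist s q ≤ dist p q := hmax (s, q) ⟨hs, hq⟩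
    rw [dist_eq_norm, dist_eq_norm] at h1
    have h2 : ⟪s - q, p - q⟫ ≤ ‖s - q‖ * ‖p - q‖ := real_inner_le_norm _ _
    have h3 : s - p = (s - q) - (p - q) := by abel
    rw [inner_smul_right, h3, inner_sub_left, real_inner_self_eq_norm_sq]
    refine mul_nonpos_of_nonneg_of_nonpos (by positivity) ?_
    nlinarith [norm_nonneg (p - q)]

theorem subsingleton_of_thickening_regular [FiniteDimensional ℝ V] {S : Set V} {ρ : ℝ}
    (hρ : 0 < ρ) (hcpt : IsCompact S) (hconv : Convex ℝ S)
    (hfr : ∀ s ∈ S, ∃ y ∈ frontier (thickening ρ S), dist s y = ρ)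
    (hreg : ∀ y ∈ frontier (thickening ρ S), ∃ F : V → ℝ, ContDiff ℝ 2 F ∧
      (∃ k, fderiv ℝ F y k = 1) ∧
      ∀ᶠ z in 𝓝 y, (z ∈ thickening ρ S → 0 < F z) ∧ (z ∈ frontier (thickening ρ S) → F z = 0)) :
    S.Subsingleton := by
  rw [← not_nontrivial_iff]
  intro hnt
  obtain ⟨w, hw, hwS⟩ := hconv.exists_unit_normal_of_interior_eq_empty hnt.nonempty
    (interior_eq_empty_of_dist_frontier_thickening hρ hfr)
  obtain ⟨p, hp, q, hq, u, hu, hqp, hL, huS⟩ := hcpt.exists_unit_sub_inner_nonpos hnt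
  have huw : ⟪u, w⟫ = 0 := by
    have := hwS p hp q hq
    rw [hqp, sub_sub_cancel_left, inner_neg_left, inner_smul_left, neg_eq_zero, mul_eq_zero] at this
    exact this.resolve_left hL.ne'
  have hy : p + ρ • w ∈ frontier (thickening ρ S) :=
    add_smul_mem_frontier_thickening hρ hp hw fun s hs => (hwS p hp s hs).le
  obtain ⟨F, hF, ⟨k, hk⟩, hloc⟩ := hreg _ hy
  refine fderiv_ne_zero_of_pos_on_ball hρ hw (hF.differentiable (by norm_num) _)
    (hloc.self_of_nhds.2 hy) hk
    (hloc.mono fun z hz hzb => hz.1 (ball_subset_thickening hp ρ hzb))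
    (fderiv_eq_zero_of_segment_arc (u := u) hF hρ hw ?_ ?_)
  · have hc : Tendsto (fun t : ℝ => p + ρ • w + t • u) (𝓝 0) (𝓝 (p + ρ • w)) :=
      Continuous.tendsto' (by fun_prop) _ _ (by simp)
    have hev := (hc.eventually hloc).filter_mono (nhdsWithin_le_nhds (s := Iio 0))
    filter_upwards [hev, Ioo_mem_nhdsLT (neg_lt_zero.2 hL)] with t ht ⟨ht1, ht2⟩
    refine ht.2 ?_
    have hmem : p + t • u ∈ S := by
      have := hconv.add_smul_sub_mem hp hq (t := -t / dist p q)
        ⟨div_nonneg (by linarith) hL.le, (div_le_one hL).2 (by linarith)⟩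
      convert this using 2
      nth_rewrite 2 [hqp]
      rw [sub_sub_cancel_left, smul_neg, smul_smul, div_mul_cancel₀ _ hL.ne', neg_smul, neg_neg]
    rw [add_right_comm]
    exact add_smul_mem_frontier_thickening hρ hmem hw fun s hs => (hwS _ hmem s hs).le
  · have hc : Tendsto (fun t : ℝ => p + √(ρ ^ 2 - t ^ 2) • w + t • u) (𝓝 0) (𝓝 (p + ρ • w)) :=
      Continuous.tendsto' (by fun_prop) _ _ (by simp [Real.sqrt_sq hρ.le])
    have hev := (hc.eventually hloc).filter_mono (nhdsWithin_le_nhds (s := Ioi 0))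
    filter_upwards [hev, Ioo_mem_nhdsGT hρ] with t ht ⟨ht1, ht2⟩
    refine ht.2 ?_
    set r := √(ρ ^ 2 - t ^ 2) with hr
    have hr2 : r ^ 2 = ρ ^ 2 - t ^ 2 := Real.sq_sqrt (by nlinarith)
    have hv : ‖(r / ρ) • w + (t / ρ) • u‖ = 1 := by
      rw [← sq_eq_sq₀ (norm_nonneg _) zero_le_one, norm_add_sq_real, inner_smul_left,
        inner_smul_right, real_inner_comm, huw, norm_smul, norm_smul, hw, hu]
      simp only [mul_zero, mul_one, add_zero, one_pow, Real.norm_eq_abs, sq_abs, div_pow, hr2]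
      field_simp
      ring
    have hpt : p + r • w + t • u = p + ρ • ((r / ρ) • w + (t / ρ) • u) := by
      rw [smul_add, smul_smul, smul_smul, mul_div_cancel₀ _ hρ.ne', mul_div_cancel₀ _ hρ.ne',
        add_assoc]
    rw [hpt]
    refine add_smul_mem_frontier_thickening hρ hp hv fun s hs => ?_
    rw [inner_add_right, inner_smul_right, inner_smul_right, hwS p hp s hs, mul_zero, zero_add]
    exact mul_nonpos_of_nonneg_of_nonpos (by positivity) (huS s hs)

theorem exists_infDist_frontier_eq_add_dist [ProperSpace V] {Ω : Set V} (hop : IsOpen Ω)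
    (hbd : Bornology.IsBounded Ω) (hfne : (frontier Ω).Nonempty) {z : V} (hz : z ∈ Ω)
    (huniq : ∀ᶠ m in 𝓝 z, ∀ x ∈ frontier Ω, ∀ y ∈ frontier Ω,
      dist m x = infDist m (frontier Ω) → dist m y = infDist m (frontier Ω) → x = y) :
    ∃ m ∈ Ω, 0 < dist z m ∧ infDist m (frontier Ω) = infDist z (frontier Ω) + dist z m := by
  have hfc : IsCompact (frontier Ω) := hbd.isCompact_closure.of_isClosed_subset isClosed_frontier
    frontier_subset_closure
  obtain ⟨δ, hδ, hball⟩ :=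
    nhds_basis_closedBall.eventually_iff.1 (huniq.and (hop.mem_nhds hz))
  have hzpos : 0 < infDist z (frontier Ω) := hop.infDist_frontier_pos hfne hz
  have hsub : closedBall z (min δ (infDist z (frontier Ω))) ⊆ closedBall z δ :=
    closedBall_subset_closedBall (min_le_left _ _)
  obtain ⟨m, hm, hmd⟩ := hfc.exists_infDist_eq_add hfne (lt_min hδ hzpos) (min_le_right _ _)
    fun m hm => (hball (hsub hm)).1
  refine ⟨m, (hball (hsub ?_)).2, ?_, ?_⟩
  · rw [mem_closedBall, dist_comm, hm]
  · rw [hm]; exact lt_min hδ hzpos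
  · rw [hm, hmd]

end Geometry

section HighRidge

variable {n : ℕ} {Ω : Set (E n)}

theorem exists_mem_highRidge_infDist_add_dist_le (hop : IsOpen Ω)
    (hbd : Bornology.IsBounded Ω) (hfne : (frontier Ω).Nonempty)
    (hcut : cutLocus Ω ⊆ highRidge Ω) {z : E n} (hz : z ∈ Ω) :
    ∃ c ∈ highRidge Ω, infDist z (frontier Ω) + dist z c ≤ infDist c (frontier Ω) := by
  have hK : IsCompact
      (closure Ω ∩ {w | infDist z (frontier Ω) + dist z w ≤ infDist w (frontier Ω)}) :=
    hbd.isCompact_closure.inter_right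
      (isClosed_le (by fun_prop) (continuous_infDist_pt _))
  obtain ⟨w, ⟨hwc, hw⟩, hmax⟩ := hK.exists_isMaxOn ⟨z, subset_closure hz, by simp⟩
    (continuous_infDist_pt (frontier Ω)).continuousOn
  rw [isMaxOn_iff] at hmax
  simp only [mem_ofPred_eq] at hw
  refine ⟨w, ?_, hw⟩
  by_contra hwR
  have hzpos : 0 < infDist z (frontier Ω) := hop.infDist_frontier_pos hfne hz
  have hwΩ : w ∈ Ω := by
    by_contra hwn
    have hwf : w ∈ frontier Ω := hop.frontier_eq ▸ ⟨hwc, hwn⟩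
    rw [infDist_zero_of_mem hwf] at hw
    linarith [dist_nonneg (x := z) (y := w)]
  have hskel : ∀ᶠ m in 𝓝 w, m ∉ skeleton Ω :=
    mem_of_superset (isClosed_closure.isOpen_compl.mem_nhds fun h => hwR (hcut h))
      fun m hm h => hm (subset_closure h)
  obtain ⟨m, hmΩ, hpos, hm⟩ := exists_infDist_frontier_eq_add_dist hop hbd hfne hwΩ (by
    filter_upwards [hskel, hop.mem_nhds hwΩ] with m hm hmΩ x hx y hy hmx hmy
    by_contra hxy
    exact hm ⟨hmΩ, x, ⟨hx, hmx⟩, y, ⟨hy, hmy⟩, hxy⟩)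
  have hle := hmax m ⟨subset_closure hmΩ, by
    simp only [mem_ofPred_eq]
    linarith [dist_triangle z w m]⟩
  linarith

theorem isCompact_highRidge (hbd : Bornology.IsBounded Ω) : IsCompact (highRidge Ω) := by
  have h : highRidge Ω = closure Ω ∩
      ⋂ z ∈ closure Ω, {x | infDist z (frontier Ω) ≤ infDist x (frontier Ω)} := by
    ext x; simp [highRidge]
  rw [h]
  exact hbd.isCompact_closure.inter_right <| isClosed_biInter fun z _ =>
    isClosed_le continuous_const (continuous_infDist_pt _)

theorem convex_highRidge (hop : IsOpen Ω) (hfne : (frontier Ω).Nonempty) (hconv : Convex ℝ Ω)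
    (hsub : highRidge Ω ⊆ Ω) : Convex ℝ (highRidge Ω) := by
  intro x hx x' hx' a b ha hb hab
  have hxx' : infDist x' (frontier Ω) = infDist x (frontier Ω) :=
    le_antisymm (hx.2 _ hx'.1) (hx'.2 _ hx.1)
  refine ⟨subset_closure (hconv (hsub hx) (hsub hx') ha hb hab), fun z hz => (hx.2 z hz).trans ?_⟩
  rw [le_infDist hfne]
  intro y hy
  by_contra! hlt
  rw [hop.frontier_eq] at hy
  refine hy.2 ?_
  set v := y - (a • x + b • x') with hv
  have hvn : ‖v‖ < infDist x (frontier Ω) := by rwa [hv, ← dist_eq_norm, dist_comm]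
  have h1 : x + v ∈ Ω := ball_infDist_frontier_subset hop (hsub hx) (by simpa [dist_eq_norm])
  have h2 : x' + v ∈ Ω := ball_infDist_frontier_subset hop (hsub hx') (by
    simpa [dist_eq_norm, hxx'])
  convert hconv h1 h2 ha hb hab using 1
  rw [smul_add, smul_add, add_add_add_comm, ← add_smul, hab, one_smul, hv, add_sub_cancel]

end HighRidge

theorem IsCkDomain.exists_defining_function {n : ℕ} {k : ℕ∞} {Ω : Set (E (n + 1))}
    (h : IsCkDomain n k Ω) (hk : k ≠ 0) {y : E (n + 1)} (hy : y ∈ frontier Ω) :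
    ∃ F : E (n + 1) → ℝ, ContDiff ℝ k F ∧ (∃ v, fderiv ℝ F y v = 1) ∧
      ∀ᶠ z in 𝓝 y, (z ∈ Ω → 0 < F z) ∧ (z ∈ frontier Ω → F z = 0) := by
  obtain ⟨e, U, g, hU, hyU, hg, hin, hfr⟩ := h y hy
  set P : E (n + 1) → E n := fun z =>
    (EuclideanSpace.equiv (Fin n) ℝ).symm (fun i => e z i.castSucc) with hP
  have he_add : ∀ z v, e (z + v) = e z + e.linearIsometryEquiv v := fun z v => by
    simpa [add_comm] using e.map_vadd z v
  have he_smooth : ContDiff ℝ k e := by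
    have h0 : (e : E (n + 1) → E (n + 1)) = fun z => e 0 + e.linearIsometryEquiv z :=
      funext fun z => by rw [← he_add, zero_add]
    rw [h0]
    exact contDiff_const.add e.linearIsometryEquiv.contDiff
  have hcoord : ∀ i, ContDiff ℝ k fun z => e z i := fun i =>
    (EuclideanSpace.proj (𝕜 := ℝ) i).contDiff.comp he_smooth
  have hPc : ContDiff ℝ k P := (EuclideanSpace.equiv (Fin n) ℝ).symm.contDiff.comp
    (contDiff_pi.2 fun i => hcoord i.castSucc)
  have hF : ContDiff ℝ k fun z => e z (Fin.last n) - g (P z) := (hcoord _).sub (hg.comp hPc)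
  refine ⟨fun z => e z (Fin.last n) - g (P z), hF,
    ⟨e.linearIsometryEquiv.symm (EuclideanSpace.single (Fin.last n) 1), ?_⟩, ?_⟩
  · set v := e.linearIsometryEquiv.symm (EuclideanSpace.single (Fin.last n) (1 : ℝ)) with hv
    have he : ∀ t : ℝ, e (y + t • v) = e y + t • EuclideanSpace.single (Fin.last n) (1 : ℝ) := by
      intro t
      rw [he_add, map_smul, hv, LinearIsometryEquiv.apply_symm_apply]
    have hline : ∀ t : ℝ, e (y + t • v) (Fin.last n) - g (P (y + t • v)) =
        t + (e y (Fin.last n) - g (P y)) := by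
      intro t
      have hPt : P (y + t • v) = P y := by
        simp [hP, he, Fin.castSucc_ne_last]
      rw [hPt, he]
      simp
      ring
    have hd := (hF.differentiable (by exact_mod_cast hk) y).lineDeriv_eq_fderiv (v := v)
    rw [← hd, lineDeriv]
    simp [hline]
  · filter_upwards [hU.mem_nhds hyU] with z hz
    exact ⟨fun h => sub_pos.2 ((hin z hz).1 h), fun h => sub_eq_zero.2 ((hfr z hz).1 h).symm⟩

/-- **Theorem.** Let `Ω ⊂ ℝⁿ` be a nonempty open bounded convex set of class `C²` whose
high ridge and cut locus coincide, `S := H(Ω) = Cut(Ω)`. Then `S` is a singleton and `Ω`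
is an open ball. -/
theorem stmt8 (n : ℕ) (Ω : Set (E (n+1))) (hne : Ω.Nonempty) (hop : IsOpen Ω)
    (hbd : Bornology.IsBounded Ω) (hconv : Convex ℝ Ω)
    (hreg : IsCkDomain n 2 Ω)
    (S : Set (E (n+1))) (hS : S = highRidge Ω) (hScut : highRidge Ω = cutLocus Ω) :
    (∃ p, S = {p}) ∧ ∃ (p : E (n+1)) (ρ : ℝ), 0 < ρ ∧ Ω = Metric.ball p ρ := by
  subst hS
  have hfne : (frontier Ω).Nonempty := nonempty_frontier_iff.2
    ⟨hne, fun h => NormedSpace.unbounded_univ ℝ (E (n + 1)) (h ▸ hbd)⟩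
  obtain ⟨p, hp, hpmax⟩ := hbd.isCompact_closure.exists_isMaxOn hne.closure
    (continuous_infDist_pt (frontier Ω)).continuousOn
  have hpS : p ∈ highRidge Ω := ⟨hp, isMaxOn_iff.1 hpmax⟩
  set ρ := infDist p (frontier Ω) with hρdef
  have hSρ : ∀ s ∈ highRidge Ω, infDist s (frontier Ω) = ρ := fun s hs =>
    le_antisymm (hpS.2 s hs.1) (hs.2 p hp)
  have hpos : ∀ z ∈ Ω, 0 < infDist z (frontier Ω) := fun z hz => hop.infDist_frontier_pos hfne hz
  have hρ : 0 < ρ := (hpos _ hne.some_mem).trans_le (hpS.2 _ (subset_closure hne.some_mem))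
  have hsub : highRidge Ω ⊆ Ω := by
    intro s hs
    by_contra hn
    have hf : s ∈ frontier Ω := hop.frontier_eq ▸ ⟨hs.1, hn⟩
    exact hρ.ne' ((hSρ s hs).symm.trans (infDist_zero_of_mem hf))
  have hΩ : thickening ρ (highRidge Ω) = Ω := by
    ext z
    rw [mem_thickening_iff]
    constructor
    · rintro ⟨s, hs, hzs⟩
      exact ball_infDist_frontier_subset hop (hsub hs) (by rwa [hSρ s hs])
    · intro hz
      obtain ⟨c, hc, hzc⟩ :=
        exists_mem_highRidge_infDist_add_dist_le hop hbd hfne hScut.ge hz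
      exact ⟨c, hc, by linarith [hpos z hz, hSρ c hc]⟩
  have hfc : IsCompact (frontier Ω) := hbd.isCompact_closure.of_isClosed_subset isClosed_frontier
    frontier_subset_closure
  have hss : (highRidge Ω).Subsingleton := by
    refine subsingleton_of_thickening_regular hρ (isCompact_highRidge hbd)
      (convex_highRidge hop hfne hconv hsub) (fun s hs => ?_) (fun y hy => ?_)
    · obtain ⟨y, hy, hsy⟩ := hfc.exists_infDist_eq_dist hfne s
      exact ⟨y, hΩ.symm ▸ hy, by rw [← hsy, hSρ s hs]⟩
    · rw [hΩ] at hy ⊢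
      exact_mod_cast hreg.exists_defining_function two_ne_zero hy
  have hSp : highRidge Ω = {p} := hss.eq_singleton_of_mem hpS
  refine ⟨⟨p, hSp⟩, p, ρ, hρ, ?_⟩
  rw [← thickening_singleton, ← hSp, hΩ]
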